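/- (Theorem 7: exponent of the equilibrium Bayes payoff.) Let A be a nonempty finite set, d : A × A → ℝ nonnegative with d(a,a) = 0 for all a (extended additively to sequences), P_0, P_1 strictly positive PMFs on A, Δ_0, Δ_1 ≥ 0 and a ≥ 0. For each n define the deterministic decision rule Φ†_n(y) = 1 if D̃ⁿ_{Δ_0}(y,P_0) − D̃ⁿ_{Δ_1}(y,P_1) ≥ a and Φ†_n(y) = 0 otherwise, where D̃ⁿ_Δ(y,P) = min_{x ∈ A^n : d(x,y) ≤ nΔ} D(P̂_x ‖ P), and define u_n = P_FN(Φ†_n, A*_{Δ_1}) + e^{a·n}·P_FP(Φ†_n, A*_{Δ_0}). Then u_n > 0 for all n, and the sequence n ↦ −(1/n)·ln u_n converges, as n → ∞, to min over all PMFs P_Y on A of max{ D̃_{Δ_1}(P_Y, P_1), D̃_{Δ_0}(P_Y, P_0) − a }. -/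

import Mathlib

open scoped Classical
open Finset Filter

noncomputable section

/-- A probability mass function on a finite alphabet, as a real-valued function. -/
def IsPMF {A : Type} [Fintype A] (P : A → ℝ) : Prop :=
  (∀ a, 0 ≤ P a) ∧ ∑ a, P a = 1

/-- Kullback--Leibler divergence `D(Q‖P) = ∑_{a : Q a > 0} Q a · ln (Q a / P a)`. -/
def klDiv {A : Type} [Fintype A] (Q P : A → ℝ) : ℝ :=
  ∑ a, if 0 < Q a then Q a * Real.log (Q a / P a) else 0

/-- First marginal of a joint PMF on `A × A`. -/
def margX {A : Type} [Fintype A] (Q : A × A → ℝ) : A → ℝ := fun a => ∑ b, Q (a, b)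

/-- Second marginal of a joint PMF on `A × A`. -/
def margY {A : Type} [Fintype A] (Q : A × A → ℝ) : A → ℝ := fun b => ∑ a, Q (a, b)

/-- Expected distortion of a joint PMF. -/
def expDist {A : Type} [Fintype A] (d : A → A → ℝ) (Q : A × A → ℝ) : ℝ :=
  ∑ q : A × A, Q q * d q.1 q.2

/-- Generalized divergence `D̃_Δ(P_Y, P)`: minimum of `D(Q_X‖P)` over joint PMFs `Q`
with second marginal `P_Y` and expected distortion at most `Δ`. -/
def Dtilde {A : Type} [Fintype A] (d : A → A → ℝ) (Δ : ℝ) (PY P : A → ℝ) : ℝ :=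
  sInf {v | ∃ Q : A × A → ℝ,
    IsPMF Q ∧ margY Q = PY ∧ expDist d Q ≤ Δ ∧ v = klDiv (margX Q) P}

/-- Earth mover distance between two PMFs. -/
def EMD {A : Type} [Fintype A] (d : A → A → ℝ) (P P' : A → ℝ) : ℝ :=
  sInf {v | ∃ R : A × A → ℝ,
    IsPMF R ∧ margX R = P ∧ margY R = P' ∧ v = expDist d R}

/-- Memoryless (product) probability of a sequence. -/
def seqProb {A : Type} {n : ℕ} (P : A → ℝ) (x : Fin n → A) : ℝ := ∏ i, P (x i)

/-- Additive extension of a per-letter distortion to sequences. -/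
def dSeq {A : Type} {n : ℕ} (d : A → A → ℝ) (x y : Fin n → A) : ℝ := ∑ i, d (x i) (y i)

/-- Empirical PMF (type) of a sequence. -/
def empP {A : Type} [Fintype A] [DecidableEq A] {n : ℕ} (x : Fin n → A) : A → ℝ :=
  fun a => ((univ.filter fun i => x i = a).card : ℝ) / (n : ℝ)

/-- Empirical entropy of a sequence. -/
def empEnt {A : Type} [Fintype A] [DecidableEq A] {n : ℕ} (y : Fin n → A) : ℝ :=
  -∑ a, if 0 < empP y a then empP y a * Real.log (empP y a) else 0

/-- Conditional type class `T(y|x)`. -/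
def condTypeClass {A : Type} [Fintype A] [DecidableEq A] {n : ℕ} (x y : Fin n → A) :
    Finset (Fin n → A) :=
  univ.filter fun y' => ∀ a b : A,
    (univ.filter fun i => x i = a ∧ y' i = b).card
      = (univ.filter fun i => x i = a ∧ y i = b).card

/-- Number of distinct conditional type classes `T(y|x)` arising from `y` with
`dn x y ≤ n·Δ`. -/
def numCondTypes {A : Type} [Fintype A] [DecidableEq A] {n : ℕ}
    (dn : (Fin n → A) → (Fin n → A) → ℝ) (Δ : ℝ) (x : Fin n → A) : ℕ :=
  ((univ.filter fun y => dn x y ≤ (n : ℝ) * Δ).image fun y => condTypeClass x y).card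

/-- The optimal attack channel `A*_Δ(y|x) = c_n(x)/|T(y|x)|` on admissible `y`,
and `0` otherwise; here `c_n(x)` is the reciprocal of the number of admissible
conditional type classes. -/
def Astar {A : Type} [Fintype A] [DecidableEq A] {n : ℕ}
    (dn : (Fin n → A) → (Fin n → A) → ℝ) (Δ : ℝ) (x y : Fin n → A) : ℝ :=
  if dn x y ≤ (n : ℝ) * Δ then
    ((numCondTypes dn Δ x : ℝ))⁻¹ / ((condTypeClass x y).card : ℝ)
  else 0

/-- A channel on `A^n`: `W x y` is the conditional probability of output `y` given input `x`. -/
def IsChannel {A : Type} [Fintype A] {n : ℕ}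
    (W : (Fin n → A) → (Fin n → A) → ℝ) : Prop :=
  (∀ x y, 0 ≤ W x y) ∧ ∀ x, ∑ y, W x y = 1

/-- The class `C_Δ` of admissible channels: those assigning zero probability to any
`y` with `dn x y > n·Δ`. -/
def InC {A : Type} [Fintype A] {n : ℕ}
    (dn : (Fin n → A) → (Fin n → A) → ℝ) (Δ : ℝ)
    (W : (Fin n → A) → (Fin n → A) → ℝ) : Prop :=
  IsChannel W ∧ ∀ x y, (n : ℝ) * Δ < dn x y → W x y = 0

/-- False positive probability: `Φ y` is the probability of deciding `H₁` given `y`. -/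
def PFP {A : Type} [Fintype A] {n : ℕ} (P0 : A → ℝ) (Φ : (Fin n → A) → ℝ)
    (A0 : (Fin n → A) → (Fin n → A) → ℝ) : ℝ :=
  ∑ x, ∑ y, seqProb P0 x * A0 x y * Φ y

/-- False negative probability. -/
def PFN {A : Type} [Fintype A] {n : ℕ} (P1 : A → ℝ) (Φ : (Fin n → A) → ℝ)
    (A1 : (Fin n → A) → (Fin n → A) → ℝ) : ℝ :=
  ∑ x, ∑ y, seqProb P1 x * A1 x y * (1 - Φ y)

/-- Sequence-level generalized divergence
`D̃ⁿ_Δ(y,P) = min_{x : d(x,y) ≤ nΔ} D(P̂_x‖P)`. -/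
def DtildeN {A : Type} [Fintype A] [DecidableEq A] {n : ℕ} (d : A → A → ℝ) (Δ : ℝ)
    (y : Fin n → A) (P : A → ℝ) : ℝ :=
  sInf {v | ∃ x : Fin n → A, dSeq d x y ≤ (n : ℝ) * Δ ∧ v = klDiv (empP x) P}

/-- The equilibrium Bayes payoff
`u_n = P_FN(Φ†_n, A*_{Δ₁}) + e^{a·n}·P_FP(Φ†_n, A*_{Δ₀})`, where `Φ†_n(y) = 1` iff
`D̃ⁿ_{Δ₀}(y,P₀) − D̃ⁿ_{Δ₁}(y,P₁) ≥ a`. -/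
def bayesPayoff {A : Type} [Fintype A] [DecidableEq A] (d : A → A → ℝ)
    (Δ0 Δ1 a : ℝ) (P0 P1 : A → ℝ) (n : ℕ) : ℝ :=
  PFN P1
      (fun y : Fin n → A =>
        if a ≤ DtildeN d Δ0 y P0 - DtildeN d Δ1 y P1 then (1 : ℝ) else 0)
      (Astar (dSeq d) Δ1)
    + Real.exp (a * n) *
      PFP P0
        (fun y : Fin n → A =>
          if a ≤ DtildeN d Δ0 y P0 - DtildeN d Δ1 y P1 then (1 : ℝ) else 0)
        (Astar (dSeq d) Δ0)


section Helpers

variable {A : Type} [Fintype A] [DecidableEq A]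

lemma sum_comp_emp {n : ℕ} (x : Fin n → A) (g : A → ℝ) :
    ∑ i, g (x i) = n * ∑ a, empP x a * g a := by
  rcases Nat.eq_zero_or_pos n with h | h
  · subst h; simp
  have hn : (n : ℝ) ≠ 0 := by positivity
  rw [← Finset.sum_fiberwise univ x (fun i => g (x i)), Finset.mul_sum]
  refine Finset.sum_congr rfl fun a _ => ?_
  rw [Finset.sum_congr rfl (g := fun _ => g a) (by intro i hi; simp at hi; rw [hi])]
  rw [Finset.sum_const, nsmul_eq_mul]
  unfold empP
  field_simp

lemma empP_nonneg {n : ℕ} (x : Fin n → A) (a : A) : 0 ≤ empP x a := by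
  unfold empP; positivity

lemma empP_pos {n : ℕ} (x : Fin n → A) (i : Fin n) : 0 < empP x (x i) := by
  unfold empP
  have : 0 < n := i.pos
  have : 0 < (univ.filter fun j => x j = x i).card := Finset.card_pos.2 ⟨i, by simp⟩
  positivity

lemma empP_isPMF {n : ℕ} (hn : 0 < n) (x : Fin n → A) : IsPMF (empP x) := by
  refine ⟨empP_nonneg x, ?_⟩
  have := sum_comp_emp x (fun _ => 1)
  simp at this
  have hn : (n : ℝ) ≠ 0 := by positivity
  have h2 : (n : ℝ) * (∑ a, empP x a) = n * 1 := by linarith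
  exact mul_left_cancel₀ hn h2

lemma klDiv_eq (Q P : A → ℝ) (hQ : ∀ a, 0 ≤ Q a) :
    klDiv Q P = ∑ a, Q a * Real.log (Q a / P a) := by
  unfold klDiv
  refine Finset.sum_congr rfl fun a _ => ?_
  split_ifs with h
  · rfl
  · have : Q a = 0 := le_antisymm (not_lt.1 h) (hQ a)
    simp [this]

lemma klDiv_nonneg' (Q P : A → ℝ) (hQ : IsPMF Q) (hP : IsPMF P) (hPp : ∀ a, 0 < P a) :
    0 ≤ klDiv Q P := by
  have h : ∑ a, (Q a - P a) ≤ klDiv Q P := by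
    unfold klDiv
    refine Finset.sum_le_sum fun a _ => ?_
    have hp := hPp a
    split_ifs with h
    · have h1 := Real.log_le_sub_one_of_pos (div_pos hp h)
      have h2 : Real.log (P a / Q a) = - Real.log (Q a / P a) := by
        rw [← Real.log_inv, inv_div]
      rw [h2] at h1
      have h3 : Q a * (P a / Q a) = P a := by field_simp
      nlinarith
    · linarith
  rw [Finset.sum_sub_distrib, hQ.2, hP.2] at h
  linarith

lemma seqProb_eq {n : ℕ} (x : Fin n → A) (P : A → ℝ) (hP : ∀ a, 0 < P a) :
    seqProb P x = Real.exp (-(n * klDiv (empP x) P)) * seqProb (empP x) x := by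
  rw [klDiv_eq _ _ (empP_nonneg x), ← sum_comp_emp x (fun a => Real.log (empP x a / P a)),
    ← Finset.sum_neg_distrib, Real.exp_sum]
  unfold seqProb
  rw [← Finset.prod_mul_distrib]
  refine Finset.prod_congr rfl fun i _ => ?_
  have h1 := empP_pos x i
  have h2 := hP (x i)
  rw [← Real.log_inv, Real.exp_log (by positivity)]
  field_simp

lemma sum_seqProb (n : ℕ) (Q : A → ℝ) (hQ : ∑ a, Q a = 1) :
    ∑ x : Fin n → A, seqProb Q x = 1 := by
  have := Finset.prod_univ_sum (fun _ : Fin n => (univ : Finset A)) (fun _ a => Q a)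
  simp only [hQ, Finset.prod_const_one, Fintype.piFinset_univ] at this
  exact this.symm

lemma seqProb_nonneg {n : ℕ} (x : Fin n → A) (Q : A → ℝ) (hQ : ∀ a, 0 ≤ Q a) :
    0 ≤ seqProb Q x := Finset.prod_nonneg fun i _ => hQ _

/-- count vector -/
def cnt {n : ℕ} {B : Type} [DecidableEq B] (x : Fin n → B) : B → Fin (n + 1) :=
  fun a => ⟨(univ.filter fun i => x i = a).card, by
    have := Finset.card_le_univ (univ.filter fun i => x i = a)
    simp at this
    omega⟩

lemma sanov {n : ℕ} (hn : 0 < n) (P : A → ℝ) (hP : ∀ a, 0 < P a) (t : ℝ)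
    (S : Finset (Fin n → A)) (hS : ∀ x ∈ S, t ≤ klDiv (empP x) P) :
    ∑ x ∈ S, seqProb P x ≤ ((n : ℝ) + 1) ^ Fintype.card A * Real.exp (-(n * t)) := by
  rw [← Finset.sum_fiberwise S (cnt (n := n) (B := A))]
  have h1 : ∀ k : A → Fin (n + 1), ∑ x ∈ S with cnt x = k, seqProb P x ≤ Real.exp (-(n * t)) := by
    intro k
    rcases Finset.eq_empty_or_nonempty (S.filter fun x => cnt x = k) with h | ⟨x0, hx0⟩
    · rw [h]; simp; positivity
    have hx0' := (Finset.mem_filter.1 hx0).2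
    have hemp : ∀ x ∈ S.filter (fun x => cnt x = k), empP x = empP x0 := by
      intro x hx
      have hx' := (Finset.mem_filter.1 hx).2
      rw [← hx0'] at hx'
      funext a
      have := congrArg Fin.val (congrFun hx' a)
      simp only [cnt] at this
      unfold empP
      rw [this]
    calc ∑ x ∈ S with cnt x = k, seqProb P x
        ≤ ∑ x ∈ S with cnt x = k, Real.exp (-(n * t)) * seqProb (empP x0) x := by
          refine Finset.sum_le_sum fun x hx => ?_
          rw [seqProb_eq x P hP, hemp x hx]
          refine mul_le_mul_of_nonneg_right ?_ (seqProb_nonneg _ _ (empP_nonneg _))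
          rw [Real.exp_le_exp]
          have := hS x (Finset.mem_filter.1 hx).1
          rw [hemp x hx] at this
          have hn' : (0 : ℝ) ≤ n := by positivity
          nlinarith
      _ ≤ ∑ x, Real.exp (-(n * t)) * seqProb (empP x0) x := by
          refine Finset.sum_le_sum_of_subset_of_nonneg (Finset.subset_univ _) fun x _ _ => ?_
          have := seqProb_nonneg x _ (empP_nonneg x0)
          positivity
      _ = _ := by
          rw [← Finset.mul_sum, sum_seqProb n _ (empP_isPMF hn x0).2, mul_one]
  calc _ ≤ ∑ k : A → Fin (n + 1), Real.exp (-(n * t)) := Finset.sum_le_sum fun k _ => h1 k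
    _ = _ := by simp

lemma condType_mem {n : ℕ} (x y : Fin n → A) : y ∈ condTypeClass x y := by
  simp [condTypeClass]

lemma condType_eq_of_mem {n : ℕ} {x y y' : Fin n → A} (h : y' ∈ condTypeClass x y) :
    condTypeClass x y' = condTypeClass x y := by
  simp only [condTypeClass, Finset.mem_filter, Finset.mem_univ, true_and] at h
  unfold condTypeClass
  ext z
  simp only [Finset.mem_filter, Finset.mem_univ, true_and, h]

lemma Astar_nonneg {n : ℕ} (dn : (Fin n → A) → (Fin n → A) → ℝ) (Δ : ℝ) (x y : Fin n → A) :
    0 ≤ Astar dn Δ x y := by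
  unfold Astar; split_ifs <;> positivity

lemma Astar_sum_le {n : ℕ} (dn : (Fin n → A) → (Fin n → A) → ℝ) (Δ : ℝ) (x : Fin n → A) :
    ∑ y, Astar dn Δ x y ≤ 1 := by
  unfold Astar
  rw [← Finset.sum_filter]
  set S := univ.filter fun y => dn x y ≤ (n : ℝ) * Δ with hS
  rw [← Finset.sum_fiberwise_of_maps_to
    (t := S.image fun y => condTypeClass x y) (g := fun y => condTypeClass x y)
    (fun y hy => Finset.mem_image_of_mem _ hy)]
  calc _ ≤ ∑ C ∈ S.image fun y => condTypeClass x y, ((numCondTypes dn Δ x : ℝ))⁻¹ := by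
        refine Finset.sum_le_sum fun C hC => ?_
        obtain ⟨y0, hy0, rfl⟩ := Finset.mem_image.1 hC
        calc _ = ∑ y ∈ S with condTypeClass x y = condTypeClass x y0,
              ((numCondTypes dn Δ x : ℝ))⁻¹ / ((condTypeClass x y0).card : ℝ) := by
              refine Finset.sum_congr rfl fun y hy => ?_
              rw [(Finset.mem_filter.1 hy).2]
          _ ≤ ∑ y ∈ condTypeClass x y0,
              ((numCondTypes dn Δ x : ℝ))⁻¹ / ((condTypeClass x y0).card : ℝ) := by
              refine Finset.sum_le_sum_of_subset_of_nonneg ?_ fun _ _ _ => by positivity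
              intro y hy
              rw [← (Finset.mem_filter.1 hy).2]
              exact condType_mem x y
          _ = _ := by
              have : 0 < (condTypeClass x y0).card := Finset.card_pos.2 ⟨y0, condType_mem x y0⟩
              rw [Finset.sum_const, nsmul_eq_mul]
              field_simp
    _ ≤ 1 := by
        rw [Finset.sum_const, nsmul_eq_mul]
        have : (S.image fun y => condTypeClass x y).card = numCondTypes dn Δ x := by
          simp only [numCondTypes, hS]
        rw [this]
        exact mul_inv_le_one

lemma numCond_le {n : ℕ} (dn : (Fin n → A) → (Fin n → A) → ℝ) (Δ : ℝ) (x : Fin n → A) :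
    (numCondTypes dn Δ x : ℝ) ≤ ((n : ℝ) + 1) ^ (Fintype.card A * Fintype.card A) := by
  have : numCondTypes dn Δ x ≤ (n + 1) ^ (Fintype.card A * Fintype.card A) := by
    unfold numCondTypes
    have h : ((univ.filter fun y => dn x y ≤ (n : ℝ) * Δ).image fun y => condTypeClass x y).card
        ≤ (univ : Finset (A × A → Fin (n + 1))).card := by
      refine Finset.card_le_card_of_surjOn (fun k => univ.filter fun y' => ∀ a b : A,
        (univ.filter fun i => x i = a ∧ y' i = b).card = (k (a, b)).val) ?_
      intro C hC
      obtain ⟨y, _, rfl⟩ := Finset.mem_image.1 (Finset.mem_coe.1 hC)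
      refine ⟨cnt (fun i => (x i, y i)), by simp, ?_⟩
      simp [cnt, condTypeClass, Prod.ext_iff]
    simpa [Finset.card_univ] using h
  exact_mod_cast this

lemma numCond_pos {n : ℕ} (dn : (Fin n → A) → (Fin n → A) → ℝ) (Δ : ℝ) (x y : Fin n → A)
    (h : dn x y ≤ n * Δ) : (0 : ℝ) < numCondTypes dn Δ x := by
  unfold numCondTypes
  have : ((univ.filter fun y => dn x y ≤ (n : ℝ) * Δ).image fun y => condTypeClass x y).Nonempty :=
    ⟨condTypeClass x y, Finset.mem_image_of_mem _ (by simpa using h)⟩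
  exact_mod_cast Finset.card_pos.2 this

lemma sum_bound {n : ℕ} (hn : 0 < n) (d : A → A → ℝ) (Δ : ℝ) (P : A → ℝ)
    (hP : IsPMF P) (hPp : ∀ a, 0 < P a)
    (Ψ : (Fin n → A) → ℝ) (hΨ1 : ∀ y, Ψ y ≤ 1) (t : ℝ)
    (ht : ∀ x y, dSeq d x y ≤ n * Δ → 0 < Ψ y → t ≤ klDiv (empP x) P) :
    ∑ x, ∑ y, seqProb P x * Astar (dSeq d) Δ x y * Ψ y ≤
      ((n : ℝ) + 1) ^ Fintype.card A * Real.exp (-(n * t)) := by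
  refine le_trans ?_ (sanov hn P hPp t (univ.filter fun x => t ≤ klDiv (empP x) P) (by simp))
  rw [Finset.sum_filter]
  refine Finset.sum_le_sum fun x _ => ?_
  have hsp := seqProb_nonneg x P hP.1
  split_ifs with h
  · calc _ ≤ ∑ y, seqProb P x * Astar (dSeq d) Δ x y := by
          refine Finset.sum_le_sum fun y _ => ?_
          have := mul_nonneg hsp (Astar_nonneg (dSeq d) Δ x y)
          nlinarith [hΨ1 y]
      _ ≤ _ := by
          rw [← Finset.mul_sum]
          have := Astar_sum_le (dSeq d) Δ x
          nlinarith
  · refine Finset.sum_nonpos fun y _ => ?_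
    have h0 := Astar_nonneg (dSeq d) Δ x y
    by_cases hd : dSeq d x y ≤ n * Δ
    · have : Ψ y ≤ 0 := by
        by_contra hc
        exact h (ht x y hd (not_le.1 hc))
      exact mul_nonpos_of_nonneg_of_nonpos (mul_nonneg hsp h0) this
    · simp [Astar, hd]

lemma fact_step (k : ℕ) : ((k : ℝ) + 1) ^ (k + 2) * Real.exp 1 ≤ ((k : ℝ) + 2) ^ (k + 2) := by
  have h1 : ((k : ℝ) + 1) / (k + 2) ≤ Real.exp (-(1 / ((k : ℝ) + 2))) := by
    have := Real.add_one_le_exp (-(1 / ((k : ℝ) + 2)))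
    have h2 : ((k : ℝ) + 1) / (k + 2) = -(1 / ((k : ℝ) + 2)) + 1 := by field_simp; ring
    linarith
  have h3 : (((k : ℝ) + 1) / (k + 2)) ^ (k + 2) ≤ Real.exp (-1) := by
    refine (pow_le_pow_left₀ (by positivity) h1 (k + 2)).trans (le_of_eq ?_)
    rw [← Real.exp_nat_mul]
    congr 1
    push_cast
    field_simp
  rw [div_pow, div_le_iff₀ (by positivity)] at h3
  calc _ ≤ Real.exp (-1) * ((k : ℝ) + 2) ^ (k + 2) * Real.exp 1 := by gcongr
    _ = _ := by
      have : Real.exp (-1) * Real.exp 1 = 1 := by rw [← Real.exp_add]; simp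
      linear_combination ((k : ℝ) + 2) ^ (k + 2) * this

lemma fact_aux (k : ℕ) : ((k + 1).factorial : ℝ) * Real.exp k ≤ ((k : ℝ) + 1) ^ (k + 2) := by
  induction k with
  | zero => simp
  | succ k ih =>
    rw [Nat.factorial_succ]
    push_cast
    rw [Real.exp_add]
    have h := fact_step k
    have h2 : (0 : ℝ) ≤ (k : ℝ) + 2 := by positivity
    calc _ = ((k : ℝ) + 2) * ((((k + 1).factorial : ℝ) * Real.exp k) * Real.exp 1) := by
          push_cast; ring
      _ ≤ ((k : ℝ) + 2) * (((k : ℝ) + 1) ^ (k + 2) * Real.exp 1) := by gcongr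
      _ ≤ ((k : ℝ) + 2) * ((k : ℝ) + 2) ^ (k + 2) := by gcongr
      _ = _ := by ring

lemma fact_bound (k : ℕ) :
    (k.factorial : ℝ) * Real.exp k ≤ Real.exp 1 * (k + 1) * (k : ℝ) ^ k := by
  cases k with
  | zero => simp
  | succ k =>
    have h := fact_aux k
    have h2 : (0 : ℝ) < ((k : ℝ) + 1) ^ (k + 1) := by positivity
    push_cast
    rw [Real.exp_add]
    calc _ = Real.exp 1 * (((k + 1).factorial : ℝ) * Real.exp k) := by ring
      _ ≤ Real.exp 1 * ((k : ℝ) + 1) ^ (k + 2) := by gcongr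
      _ = Real.exp 1 * ((k : ℝ) + 1) * ((k : ℝ) + 1) ^ (k + 1) := by ring
      _ ≤ _ := by gcongr; linarith

/-- orbit under coordinate permutations -/
def orb {n : ℕ} (x : Fin n → A) : Finset (Fin n → A) :=
  univ.image fun σ : Equiv.Perm (Fin n) => x ∘ σ

lemma orb_card {n : ℕ} (x : Fin n → A) :
    n.factorial ≤ (∏ a, ((univ.filter fun i => x i = a).card).factorial) * (orb x).card := by
  have hs : (univ.filter fun σ : Equiv.Perm (Fin n) => x ∘ σ = x).card
      = ∏ a, ((univ.filter fun i => x i = a).card).factorial := by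
    have := DomMulAct.stabilizer_card x
    rw [Fintype.card_subtype] at this
    simp only [Fintype.card_subtype] at this
    convert this
  rw [← hs]
  have h := Finset.card_le_mul_card_image (f := fun σ : Equiv.Perm (Fin n) => x ∘ σ) univ
    (univ.filter fun σ : Equiv.Perm (Fin n) => x ∘ σ = x).card (by
      intro b hb
      obtain ⟨σ0, _, rfl⟩ := Finset.mem_image.1 hb
      refine Finset.card_le_card_of_injOn (fun σ => σ * σ0⁻¹) ?_ ?_
      · intro σ hσ
        simp only [Finset.coe_filter, Finset.mem_univ, true_and, Set.mem_setOf_eq] at hσ ⊢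
        funext i
        have := congrFun hσ (σ0⁻¹ i)
        simpa using this
      · intro σ _ τ _ h
        simpa using h)
  simpa [Fintype.card_perm, orb] using h

lemma seqProb_emp {n : ℕ} (Q : A → ℝ) (x : Fin n → A) :
    seqProb Q x = ∏ a, Q a ^ (univ.filter fun i => x i = a).card := by
  unfold seqProb
  rw [← Finset.prod_fiberwise univ x (fun i => Q (x i))]
  refine Finset.prod_congr rfl fun a _ => ?_
  rw [Finset.prod_congr rfl (g := fun _ => Q a) (by intro i hi; simp at hi; rw [hi])]
  rw [Finset.prod_const]

lemma sum_cnt {n : ℕ} (x : Fin n → A) : ∑ a, (univ.filter fun i => x i = a).card = n := by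
  have := Finset.card_eq_sum_card_fiberwise (f := x) (s := univ) (t := univ) (by intro; simp)
  simpa using this.symm

lemma type_lower {n : ℕ} (hn : 0 < n) (x : Fin n → A) :
    1 ≤ (Real.exp 1 * (n + 1)) ^ Fintype.card A * ((orb x).card * seqProb (empP x) x) := by
  have hpos : (0 : ℝ) < (n : ℝ) ^ n := by positivity
  have h1 : (n : ℝ) ^ n ≤ n.factorial * Real.exp n := by
    have := Real.pow_div_factorial_le_exp (n : ℝ) (by positivity) n
    rw [div_le_iff₀ (by positivity)] at this
    linarith
  have h2 : (n.factorial : ℝ) ≤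
      (∏ a, (((univ.filter fun i => x i = a).card).factorial : ℝ)) * (orb x).card := by
    exact_mod_cast orb_card x
  have h3 : (∏ a, (((univ.filter fun i => x i = a).card).factorial : ℝ)) * Real.exp n
      ≤ (Real.exp 1 * (n + 1)) ^ Fintype.card A *
        ∏ a, ((univ.filter fun i => x i = a).card : ℝ) ^ (univ.filter fun i => x i = a).card := by
    have he : Real.exp n = ∏ a, Real.exp ((univ.filter fun i => x i = a).card : ℝ) := by
      rw [← Real.exp_sum]
      congr 1
      exact_mod_cast (sum_cnt x).symm
    have hc : (Real.exp 1 * ((n : ℝ) + 1)) ^ Fintype.card A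
        = ∏ _a : A, (Real.exp 1 * ((n : ℝ) + 1)) := by simp [Finset.card_univ]
    rw [he, hc, ← Finset.prod_mul_distrib, ← Finset.prod_mul_distrib]
    refine Finset.prod_le_prod (fun a _ => by positivity) fun a _ => ?_
    refine (fact_bound _).trans ?_
    have : ((univ.filter fun i => x i = a).card : ℝ) ≤ n := by
      have := Finset.card_le_univ (univ.filter fun i => x i = a)
      simp only [Fintype.card_fin] at this
      exact_mod_cast this
    gcongr
  have h4 : seqProb (empP x) x = (∏ a, ((univ.filter fun i => x i = a).card : ℝ) ^
      (univ.filter fun i => x i = a).card) / (n : ℝ) ^ n := by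
    rw [seqProb_emp]
    unfold empP
    simp only [div_pow]
    rw [Finset.prod_div_distrib, Finset.prod_pow_eq_pow_sum, sum_cnt]
  rw [h4]
  have h5 : (n : ℝ) ^ n ≤ (Real.exp 1 * (n + 1)) ^ Fintype.card A *
        (∏ a, ((univ.filter fun i => x i = a).card : ℝ) ^ (univ.filter fun i => x i = a).card)
        * (orb x).card := by
    calc (n : ℝ) ^ n ≤ n.factorial * Real.exp n := h1
      _ ≤ ((∏ a, (((univ.filter fun i => x i = a).card).factorial : ℝ)) * (orb x).card)
          * Real.exp n := by gcongr
      _ = ((∏ a, (((univ.filter fun i => x i = a).card).factorial : ℝ)) * Real.exp n)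
          * (orb x).card := by ring
      _ ≤ _ := by gcongr
  have h6 : 1 ≤ ((Real.exp 1 * (n + 1)) ^ Fintype.card A *
        (∏ a, ((univ.filter fun i => x i = a).card : ℝ) ^ (univ.filter fun i => x i = a).card)
        * (orb x).card) / (n : ℝ) ^ n := by
    rw [le_div_iff₀ hpos]; linarith
  refine h6.trans (le_of_eq ?_)
  ring

lemma seqProb_perm {n : ℕ} (Q : A → ℝ) (x : Fin n → A) (σ : Equiv.Perm (Fin n)) :
    seqProb Q (x ∘ σ) = seqProb Q x := by
  unfold seqProb
  exact Equiv.prod_comp σ (fun i => Q (x i))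

lemma dSeq_perm {n : ℕ} (d : A → A → ℝ) (x y : Fin n → A) (σ : Equiv.Perm (Fin n)) :
    dSeq d (x ∘ σ) (y ∘ σ) = dSeq d x y := by
  unfold dSeq
  exact Equiv.sum_comp σ (fun i => d (x i) (y i))

lemma card_fiber_perm {n : ℕ} {B : Type} [DecidableEq B] (x : Fin n → B)
    (σ : Equiv.Perm (Fin n)) (a : B) :
    (univ.filter fun i => (x ∘ σ) i = a).card = (univ.filter fun i => x i = a).card := by
  refine Finset.card_bij (fun i _ => σ i) (by simp) (by simp) ?_
  intro b hb
  exact ⟨σ.symm b, by simpa using hb, by simp⟩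

lemma empP_perm {n : ℕ} (x : Fin n → A) (σ : Equiv.Perm (Fin n)) :
    empP (x ∘ σ) = empP x := by
  funext a
  unfold empP
  rw [card_fiber_perm x σ a]

lemma exists_perm {n : ℕ} {B : Type} [DecidableEq B] (f g : Fin n → B)
    (h : ∀ b, (univ.filter fun i => f i = b).card = (univ.filter fun i => g i = b).card) :
    ∃ σ : Equiv.Perm (Fin n), f = g ∘ σ := by
  have e : ∀ c, Nonempty ({a // f a = c} ≃ {b // g b = c}) := fun c => by
    refine ⟨Fintype.equivOfCardEq ?_⟩
    rw [Fintype.card_subtype, Fintype.card_subtype, h]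
  refine ⟨Equiv.ofFiberEquiv fun c => (e c).some, ?_⟩
  funext i
  exact (Equiv.ofFiberEquiv_map (fun c => (e c).some) i).symm

lemma DtildeN_perm {n : ℕ} (d : A → A → ℝ) (Δ : ℝ) (y : Fin n → A) (P : A → ℝ)
    (σ : Equiv.Perm (Fin n)) : DtildeN d Δ (y ∘ σ) P = DtildeN d Δ y P := by
  unfold DtildeN
  congr 1
  ext v
  constructor
  · rintro ⟨x, hx, rfl⟩
    refine ⟨x ∘ σ.symm, ?_, (by rw [empP_perm])⟩
    rw [← dSeq_perm d _ y σ]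
    have : (x ∘ σ.symm) ∘ σ = x := by funext i; simp
    rwa [this]
  · rintro ⟨x, hx, rfl⟩
    exact ⟨x ∘ σ, by rwa [dSeq_perm], by rw [empP_perm]⟩

lemma condType_perm {n : ℕ} {x y y' : Fin n → A} (h : y' ∈ condTypeClass x y) :
    ∃ τ : Equiv.Perm (Fin n), x = x ∘ τ ∧ y' = y ∘ τ := by
  simp only [condTypeClass, Finset.mem_filter, Finset.mem_univ, true_and] at h
  obtain ⟨τ, hτ⟩ := exists_perm (fun i => (x i, y' i)) (fun i => (x i, y i)) (by
    rintro ⟨a, b⟩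
    simpa [Prod.ext_iff] using h a b)
  refine ⟨τ, ?_, ?_⟩
  · funext i; exact congrArg Prod.fst (congrFun hτ i)
  · funext i; exact congrArg Prod.snd (congrFun hτ i)

lemma sum_lower {n : ℕ} (hn : 0 < n) (d : A → A → ℝ) (Δ : ℝ) (P : A → ℝ)
    (hPp : ∀ a, 0 < P a)
    (Ψ : (Fin n → A) → ℝ) (hΨ0 : ∀ y, 0 ≤ Ψ y) (x y : Fin n → A)
    (hxy : dSeq d x y ≤ n * Δ) (hΨ : ∀ τ : Equiv.Perm (Fin n), Ψ (y ∘ τ) = 1) :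
    Real.exp (-(n * klDiv (empP x) P)) ≤
    ((n : ℝ) + 1) ^ (Fintype.card A * Fintype.card A) *
      (Real.exp 1 * (n + 1)) ^ Fintype.card A *
    ∑ x, ∑ y, seqProb P x * Astar (dSeq d) Δ x y * Ψ y := by
  have hterm : ∀ x' y', 0 ≤ seqProb P x' * Astar (dSeq d) Δ x' y' * Ψ y' := fun x' y' =>
    mul_nonneg (mul_nonneg (seqProb_nonneg _ _ fun a => (hPp a).le) (Astar_nonneg _ _ _ _))
      (hΨ0 _)
  have h1 : (orb x).card * seqProb P x / ((n : ℝ) + 1) ^ (Fintype.card A * Fintype.card A) ≤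
      ∑ x, ∑ y, seqProb P x * Astar (dSeq d) Δ x y * Ψ y := by
    calc _ = ∑ x' ∈ orb x, seqProb P x / ((n : ℝ) + 1) ^ (Fintype.card A * Fintype.card A) := by
          rw [Finset.sum_const, nsmul_eq_mul]; ring
      _ ≤ ∑ x' ∈ orb x, ∑ y', seqProb P x' * Astar (dSeq d) Δ x' y' * Ψ y' := by
          refine Finset.sum_le_sum fun x' hx' => ?_
          obtain ⟨σ, _, rfl⟩ := Finset.mem_image.1 hx'
          have hadm : dSeq d (x ∘ σ) (y ∘ σ) ≤ n * Δ := by rwa [dSeq_perm]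
          have hnp := numCond_pos (dSeq d) Δ (x ∘ σ) (y ∘ σ) hadm
          have hsp : 0 ≤ seqProb P x := seqProb_nonneg _ _ fun a => (hPp a).le
          have hcp : 0 < (condTypeClass (x ∘ σ) (y ∘ σ)).card :=
            Finset.card_pos.2 ⟨_, condType_mem _ _⟩
          calc _ ≤ seqProb P x * (numCondTypes (dSeq d) Δ (x ∘ σ) : ℝ)⁻¹ := by
                rw [div_eq_mul_inv]
                have := numCond_le (dSeq d) Δ (x ∘ σ)
                gcongr
            _ = ∑ y' ∈ condTypeClass (x ∘ σ) (y ∘ σ), seqProb P x *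
                ((numCondTypes (dSeq d) Δ (x ∘ σ) : ℝ)⁻¹ /
                  ((condTypeClass (x ∘ σ) (y ∘ σ)).card : ℝ)) := by
                rw [Finset.sum_const, nsmul_eq_mul]
                field_simp
            _ = ∑ y' ∈ condTypeClass (x ∘ σ) (y ∘ σ),
                  seqProb P (x ∘ σ) * Astar (dSeq d) Δ (x ∘ σ) y' * Ψ y' := by
                refine Finset.sum_congr rfl fun y' hy' => ?_
                have hc := condType_eq_of_mem hy'
                obtain ⟨τ, hτ1, hτ2⟩ := condType_perm hy'
                have hd' : dSeq d (x ∘ σ) y' ≤ n * Δ := by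
                  rw [hτ1, hτ2, dSeq_perm]; exact hadm
                have hΨ' : Ψ y' = 1 := by
                  rw [hτ2]
                  exact hΨ (σ * τ)
                unfold Astar
                rw [if_pos hd', hΨ', hc, seqProb_perm, mul_one]
            _ ≤ _ := Finset.sum_le_sum_of_subset_of_nonneg (Finset.subset_univ _)
                fun y' _ _ => hterm _ _
      _ ≤ _ := Finset.sum_le_sum_of_subset_of_nonneg (Finset.subset_univ _)
                fun x' _ _ => Finset.sum_nonneg fun y' _ => hterm _ _
  rw [div_le_iff₀ (by positivity), seqProb_eq x P hPp] at h1
  have h2 := type_lower hn x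
  have h3 := Real.exp_pos (-(n * klDiv (empP x) P))
  calc _ ≤ Real.exp (-(n * klDiv (empP x) P)) * ((Real.exp 1 * (n + 1)) ^ Fintype.card A *
        ((orb x).card * seqProb (empP x) x)) := by nlinarith
    _ = (Real.exp 1 * (n + 1)) ^ Fintype.card A *
        ((orb x).card * (Real.exp (-(n * klDiv (empP x) P)) * seqProb (empP x) x)) := by ring
    _ ≤ (Real.exp 1 * (n + 1)) ^ Fintype.card A *
        ((∑ x, ∑ y, seqProb P x * Astar (dSeq d) Δ x y * Ψ y) *
          ((n : ℝ) + 1) ^ (Fintype.card A * Fintype.card A)) :=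
        mul_le_mul_of_nonneg_left h1 (by positivity)
    _ = _ := by ring

lemma dSeq_self {n : ℕ} (d : A → A → ℝ) (hdrefl : ∀ a, d a a = 0) (y : Fin n → A) :
    dSeq d y y = 0 := by simp [dSeq, hdrefl]

lemma sum_pos_aux {n : ℕ} (d : A → A → ℝ) (hdrefl : ∀ a, d a a = 0) (Δ : ℝ) (hΔ : 0 ≤ Δ)
    (P : A → ℝ) (hPp : ∀ a, 0 < P a)
    (Ψ : (Fin n → A) → ℝ) (hΨ0 : ∀ y, 0 ≤ Ψ y) (y : Fin n → A) (hy : Ψ y = 1) :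
    0 < ∑ x, ∑ y, seqProb P x * Astar (dSeq d) Δ x y * Ψ y := by
  have hterm : ∀ x' y', 0 ≤ seqProb P x' * Astar (dSeq d) Δ x' y' * Ψ y' := fun x' y' =>
    mul_nonneg (mul_nonneg (seqProb_nonneg _ _ fun a => (hPp a).le) (Astar_nonneg _ _ _ _))
      (hΨ0 _)
  refine Finset.sum_pos' (fun x _ => Finset.sum_nonneg fun y _ => hterm x y)
    ⟨y, Finset.mem_univ _, Finset.sum_pos' (fun y' _ => hterm y y') ⟨y, Finset.mem_univ _, ?_⟩⟩
  have hadm : dSeq d y y ≤ n * Δ := by rw [dSeq_self d hdrefl]; positivity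
  have h1 : 0 < seqProb P y := Finset.prod_pos fun i _ => hPp _
  have h2 := numCond_pos (dSeq d) Δ y y hadm
  have h3 : 0 < (condTypeClass y y).card := Finset.card_pos.2 ⟨_, condType_mem _ _⟩
  rw [hy, Astar, if_pos hadm]
  positivity

lemma sum_nonneg_aux {n : ℕ} (d : A → A → ℝ) (Δ : ℝ)
    (P : A → ℝ) (hPp : ∀ a, 0 < P a)
    (Ψ : (Fin n → A) → ℝ) (hΨ0 : ∀ y, 0 ≤ Ψ y) :
    0 ≤ ∑ x, ∑ y, seqProb P x * Astar (dSeq d) Δ x y * Ψ y :=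
  Finset.sum_nonneg fun x _ => Finset.sum_nonneg fun y _ =>
    mul_nonneg (mul_nonneg (seqProb_nonneg _ _ fun a => (hPp a).le) (Astar_nonneg _ _ _ _))
      (hΨ0 _)

lemma margX_emp {n : ℕ} (x y : Fin n → A) : margX (empP fun i => (x i, y i)) = empP x := by
  funext a
  unfold margX empP
  rw [← Finset.sum_div]
  congr 1
  rw [Finset.card_eq_sum_card_fiberwise (f := y) (s := univ.filter fun i => x i = a) (t := univ)
    (by intro; simp)]
  push_cast
  refine Finset.sum_congr rfl fun b _ => ?_
  rw [Finset.filter_filter]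
  simp only [Prod.ext_iff]

lemma margY_emp {n : ℕ} (x y : Fin n → A) : margY (empP fun i => (x i, y i)) = empP y := by
  funext a
  unfold margY empP
  rw [← Finset.sum_div]
  congr 1
  rw [Finset.card_eq_sum_card_fiberwise (f := x) (s := univ.filter fun i => y i = a) (t := univ)
    (by intro; simp)]
  push_cast
  refine Finset.sum_congr rfl fun b _ => ?_
  rw [Finset.filter_filter]
  simp only [Prod.ext_iff]
  congr 2
  ext i
  simp [and_comm]

lemma expDist_emp {n : ℕ} (d : A → A → ℝ) (x y : Fin n → A) :
    dSeq d x y = n * expDist d (empP fun i => (x i, y i)) :=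
  sum_comp_emp (fun i => (x i, y i)) (fun q => d q.1 q.2)

lemma marg_pmf (Q : A × A → ℝ) (hQ : IsPMF Q) : IsPMF (margX Q) := by
  refine ⟨fun a => Finset.sum_nonneg fun b _ => hQ.1 _, ?_⟩
  rw [← hQ.2, Fintype.sum_prod_type]
  rfl

lemma Dtilde_bdd (d : A → A → ℝ) (Δ : ℝ) (PY P : A → ℝ) (hP : IsPMF P) (hPp : ∀ a, 0 < P a) :
    BddBelow {v | ∃ Q : A × A → ℝ,
      IsPMF Q ∧ margY Q = PY ∧ expDist d Q ≤ Δ ∧ v = klDiv (margX Q) P} := by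
  refine ⟨0, ?_⟩
  rintro v ⟨Q, hQ, _, _, rfl⟩
  exact klDiv_nonneg' _ _ (marg_pmf Q hQ) hP hPp

lemma Dtilde_nonempty (d : A → A → ℝ) (hdrefl : ∀ a, d a a = 0) (Δ : ℝ) (hΔ : 0 ≤ Δ)
    (PY P : A → ℝ) (hPY : IsPMF PY) :
    {v | ∃ Q : A × A → ℝ,
      IsPMF Q ∧ margY Q = PY ∧ expDist d Q ≤ Δ ∧ v = klDiv (margX Q) P}.Nonempty := by
  refine ⟨_, fun q => if q.1 = q.2 then PY q.1 else 0, ⟨?_, ?_⟩, ?_, ?_, rfl⟩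
  · intro q; dsimp only; split_ifs
    · exact hPY.1 _
    · exact le_rfl
  · rw [Fintype.sum_prod_type]
    simpa using hPY.2
  · funext b
    simp [margY]
  · unfold expDist
    rw [Fintype.sum_prod_type]
    simpa [hdrefl] using hΔ

lemma Dtilde_nonneg (d : A → A → ℝ) (Δ : ℝ) (PY P : A → ℝ) (hP : IsPMF P)
    (hPp : ∀ a, 0 < P a) : 0 ≤ Dtilde d Δ PY P := by
  refine Real.sInf_nonneg ?_
  rintro v ⟨Q, hQ, _, _, rfl⟩
  exact klDiv_nonneg' _ _ (marg_pmf Q hQ) hP hPp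

lemma DtildeN_le {n : ℕ} (hn : 0 < n) (d : A → A → ℝ) (Δ : ℝ) (P : A → ℝ) (hP : IsPMF P)
    (hPp : ∀ a, 0 < P a) (x y : Fin n → A) (hxy : dSeq d x y ≤ n * Δ) :
    DtildeN d Δ y P ≤ klDiv (empP x) P := by
  refine csInf_le ⟨0, ?_⟩ ⟨x, hxy, rfl⟩
  rintro v ⟨x, _, rfl⟩
  exact klDiv_nonneg' _ _ (empP_isPMF hn x) hP hPp

lemma Dtilde_le {n : ℕ} (hn : 0 < n) (d : A → A → ℝ) (hdrefl : ∀ a, d a a = 0)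
    (Δ : ℝ) (hΔ : 0 ≤ Δ) (P : A → ℝ) (hP : IsPMF P)
    (hPp : ∀ a, 0 < P a) (y : Fin n → A) :
    Dtilde d Δ (empP y) P ≤ DtildeN d Δ y P := by
  refine le_csInf ⟨_, y, by rw [dSeq_self d hdrefl]; positivity, rfl⟩ ?_
  rintro v ⟨x, hx, rfl⟩
  refine csInf_le (Dtilde_bdd d Δ _ P hP hPp)
    ⟨empP fun i => (x i, y i), empP_isPMF hn _, margY_emp x y, ?_, by rw [margX_emp]⟩
  rw [expDist_emp] at hx
  have hn' : (0 : ℝ) < n := by exact_mod_cast hn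
  exact le_of_mul_le_mul_left hx hn'

lemma bayes_pos [Nonempty A]
    (d : A → A → ℝ) (hdrefl : ∀ a, d a a = 0)
    (P0 P1 : A → ℝ) (hP0pos : ∀ a, 0 < P0 a) (hP1pos : ∀ a, 0 < P1 a)
    (Δ0 Δ1 a : ℝ) (hΔ0 : 0 ≤ Δ0) (hΔ1 : 0 ≤ Δ1) (n : ℕ) :
    0 < bayesPayoff d Δ0 Δ1 a P0 P1 n := by
  obtain ⟨b⟩ := ‹Nonempty A›
  unfold bayesPayoff PFN PFP
  set Φ : (Fin n → A) → ℝ := fun y => if a ≤ DtildeN d Δ0 y P0 - DtildeN d Δ1 y P1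
    then (1 : ℝ) else 0 with hΦ
  have h0 : ∀ y, 0 ≤ Φ y := fun y => by simp only [hΦ]; split_ifs <;> norm_num
  have h1 : ∀ y, 0 ≤ 1 - Φ y := fun y => by simp only [hΦ]; split_ifs <;> norm_num
  have n0 := sum_nonneg_aux d Δ0 P0 hP0pos Φ h0
  have n1 := sum_nonneg_aux d Δ1 P1 hP1pos (fun y => 1 - Φ y) h1
  have he := Real.exp_pos (a * n)
  set y0 : Fin n → A := fun _ => b
  by_cases hc : a ≤ DtildeN d Δ0 y0 P0 - DtildeN d Δ1 y0 P1
  · have := sum_pos_aux d hdrefl Δ0 hΔ0 P0 hP0pos Φ h0 y0 (by simp only [hΦ]; rw [if_pos hc])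
    positivity
  · have := sum_pos_aux d hdrefl Δ1 hΔ1 P1 hP1pos (fun y => 1 - Φ y) h1 y0
      (by simp only [hΦ]; rw [if_neg hc]; norm_num)
    positivity

lemma bayes_upper
    (d : A → A → ℝ) (hdrefl : ∀ a, d a a = 0)
    (P0 P1 : A → ℝ) (hP0 : IsPMF P0) (hP1 : IsPMF P1)
    (hP0pos : ∀ a, 0 < P0 a) (hP1pos : ∀ a, 0 < P1 a)
    (Δ0 Δ1 a : ℝ) (hΔ0 : 0 ≤ Δ0) (hΔ1 : 0 ≤ Δ1) (n : ℕ) (hn : 0 < n) (V : ℝ)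
    (hV : ∀ PY : A → ℝ, IsPMF PY → V ≤ max (Dtilde d Δ1 PY P1) (Dtilde d Δ0 PY P0 - a)) :
    bayesPayoff d Δ0 Δ1 a P0 P1 n ≤
      2 * ((n : ℝ) + 1) ^ Fintype.card A * Real.exp (-(n * V)) := by
  unfold bayesPayoff PFN PFP
  have hV' : ∀ y : Fin n → A, V ≤ max (DtildeN d Δ1 y P1) (DtildeN d Δ0 y P0 - a) := fun y =>
    (hV _ (empP_isPMF hn y)).trans (max_le_max (Dtilde_le hn d hdrefl Δ1 hΔ1 P1 hP1 hP1pos y)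
      (sub_le_sub_right (Dtilde_le hn d hdrefl Δ0 hΔ0 P0 hP0 hP0pos y) a))
  set Φ : (Fin n → A) → ℝ := fun y => if a ≤ DtildeN d Δ0 y P0 - DtildeN d Δ1 y P1
    then (1 : ℝ) else 0 with hΦ
  have h0 := sum_bound hn d Δ0 P0 hP0 hP0pos Φ
    (fun y => by simp only [hΦ]; split_ifs <;> norm_num) (V + a) (by
      intro x y hxy hy
      have hc : a ≤ DtildeN d Δ0 y P0 - DtildeN d Δ1 y P1 := by
        by_contra hc
        simp only [hΦ] at hy
        rw [if_neg hc] at hy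
        exact lt_irrefl _ hy
      have h1 := DtildeN_le hn d Δ0 P0 hP0 hP0pos x y hxy
      have h2 := hV' y
      rw [max_eq_right (by linarith)] at h2
      linarith)
  have h1 := sum_bound hn d Δ1 P1 hP1 hP1pos (fun y => 1 - Φ y)
    (fun y => by simp only [hΦ]; split_ifs <;> norm_num) V (by
      intro x y hxy hy
      have hc : ¬ a ≤ DtildeN d Δ0 y P0 - DtildeN d Δ1 y P1 := by
        intro hc
        simp only [hΦ] at hy
        rw [if_pos hc] at hy
        simp at hy
      have h1 := DtildeN_le hn d Δ1 P1 hP1 hP1pos x y hxy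
      have h2 := hV' y
      rw [max_eq_left (by linarith)] at h2
      linarith)
  have he := Real.exp_pos (a * n)
  have h2 := mul_le_mul_of_nonneg_left h0 he.le
  have h3 : Real.exp (a * n) * (((n : ℝ) + 1) ^ Fintype.card A * Real.exp (-(n * (V + a))))
      = ((n : ℝ) + 1) ^ Fintype.card A * Real.exp (-(n * V)) := by
    rw [mul_left_comm, ← Real.exp_add]
    congr 2
    ring
  linarith

lemma bayes_lower
    (d : A → A → ℝ)
    (P0 P1 : A → ℝ)
    (hP0pos : ∀ a, 0 < P0 a) (hP1pos : ∀ a, 0 < P1 a)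
    (Δ0 Δ1 a : ℝ) (n : ℕ) (hn : 0 < n) (W : ℝ)
    (x0 x1 y : Fin n → A) (h0 : dSeq d x0 y ≤ n * Δ0) (h1 : dSeq d x1 y ≤ n * Δ1)
    (hW0 : klDiv (empP x0) P0 - a ≤ W) (hW1 : klDiv (empP x1) P1 ≤ W) :
    Real.exp (-(n * W)) ≤ ((n : ℝ) + 1) ^ (Fintype.card A * Fintype.card A) *
      (Real.exp 1 * (n + 1)) ^ Fintype.card A * bayesPayoff d Δ0 Δ1 a P0 P1 n := by
  unfold bayesPayoff PFN PFP
  set Φ : (Fin n → A) → ℝ := fun y => if a ≤ DtildeN d Δ0 y P0 - DtildeN d Δ1 y P1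
    then (1 : ℝ) else 0 with hΦ
  have g0 : ∀ y, 0 ≤ Φ y := fun y => by simp only [hΦ]; split_ifs <;> norm_num
  have g1 : ∀ y, 0 ≤ 1 - Φ y := fun y => by simp only [hΦ]; split_ifs <;> norm_num
  have n0 := sum_nonneg_aux d Δ0 P0 hP0pos Φ g0
  have n1 := sum_nonneg_aux d Δ1 P1 hP1pos (fun y => 1 - Φ y) g1
  have he := Real.exp_pos (a * n)
  have hn' : (0 : ℝ) ≤ n := by positivity
  set R : ℝ := ((n : ℝ) + 1) ^ (Fintype.card A * Fintype.card A) *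
      (Real.exp 1 * (n + 1)) ^ Fintype.card A with hR
  have hRpos : 0 < R := by positivity
  by_cases hc : a ≤ DtildeN d Δ0 y P0 - DtildeN d Δ1 y P1
  · have h := sum_lower hn d Δ0 P0 hP0pos Φ g0 x0 y h0
      (fun τ => by simp only [hΦ, DtildeN_perm]; rw [if_pos hc])
    rw [← hR] at h
    calc _ ≤ Real.exp (a * n) * Real.exp (-(n * klDiv (empP x0) P0)) := by
          rw [← Real.exp_add, Real.exp_le_exp]; nlinarith
      _ ≤ Real.exp (a * n) * (R * _) := mul_le_mul_of_nonneg_left h he.le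
      _ ≤ _ := by
          have := mul_nonneg hRpos.le n1
          rw [mul_add]
          refine le_trans (le_of_eq ?_) (le_add_of_nonneg_left this)
          ring
  · have h := sum_lower hn d Δ1 P1 hP1pos (fun y => 1 - Φ y) g1 x1 y h1
      (fun τ => by simp only [hΦ, DtildeN_perm]; rw [if_neg hc]; norm_num)
    rw [← hR] at h
    calc _ ≤ Real.exp (-(n * klDiv (empP x1) P1)) := by
          rw [Real.exp_le_exp]; nlinarith
      _ ≤ (R * _) := h
      _ ≤ _ := by
          rw [mul_add]
          exact le_add_of_nonneg_right (by positivity)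

lemma exists_fun {n : ℕ} {B : Type} [Fintype B] [DecidableEq B] (c : B → ℕ) (hc : ∑ b, c b = n) :
    ∃ z : Fin n → B, ∀ b, (univ.filter fun i => z i = b).card = c b := by
  have e : Fin n ≃ Σ b, Fin (c b) := Fintype.equivOfCardEq (by simp [hc])
  refine ⟨fun i => (e i).1, fun b => ?_⟩
  have h : (univ.filter fun i => (e i).1 = b).card
      = (univ.filter fun s : Σ b, Fin (c b) => s.1 = b).card := by
    refine Finset.card_bij (fun i _ => e i) (by simp) (by simp) ?_
    intro s hs
    exact ⟨e.symm s, by simpa using hs, by simp⟩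
  rw [h, ← Fintype.card_subtype, Fintype.card_congr (Equiv.sigmaSubtype b), Fintype.card_fin]

lemma exists_x {n : ℕ} (y : Fin n → A) (J : A × A → ℕ)
    (hJ : ∀ b, ∑ a, J (a, b) = (univ.filter fun i => y i = b).card) :
    ∃ x : Fin n → A, ∀ q, (univ.filter fun i => (x i, y i) = q).card = J q := by
  obtain ⟨z, hz⟩ := exists_fun (n := n) J (by
    rw [Fintype.sum_prod_type_right]
    simp only [hJ]
    exact sum_cnt y)
  obtain ⟨σ, hσ⟩ := exists_perm y (fun i => (z i).2) (by
    intro b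
    rw [← hJ b, Finset.card_eq_sum_card_fiberwise (f := fun i => (z i).1)
      (s := univ.filter fun i => (z i).2 = b) (t := univ) (by intro; simp)]
    refine Finset.sum_congr rfl fun a _ => ?_
    rw [← hz, Finset.filter_filter]
    congr 1
    ext i
    simp [Prod.ext_iff, and_comm])
  refine ⟨fun i => (z (σ i)).1, fun q => ?_⟩
  rw [← hz q, ← card_fiber_perm z σ q]
  congr 1
  ext i
  have : y i = (z (σ i)).2 := congrFun hσ i
  simp [this]

/-- Rounded output counts. -/
def NY (PY : A → ℝ) (b0 : A) (n : ℕ) (b : A) : ℕ :=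
  ⌊PY b * n⌋₊ + if b = b0 then n - ∑ b', ⌊PY b' * n⌋₊ else 0

/-- Rounded joint counts. -/
def JQ (Q : A × A → ℝ) (PY : A → ℝ) (b0 : A) (n : ℕ) (q : A × A) : ℕ :=
  if q.1 = q.2 then NY PY b0 n q.2 - ∑ a' ∈ univ.erase q.2, ⌊Q (a', q.2) * n⌋₊
  else ⌊Q q * n⌋₊

lemma sum_floor_le {B : Type} (s : Finset B) (f : B → ℝ) (hf : ∀ b, 0 ≤ f b) (n : ℕ) :
    (∑ b ∈ s, (⌊f b * n⌋₊ : ℝ)) ≤ (∑ b ∈ s, f b) * n := by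
  rw [Finset.sum_mul]
  exact Finset.sum_le_sum fun b _ => Nat.floor_le (mul_nonneg (hf b) (by positivity))

lemma NY_le (PY : A → ℝ) (hPY : IsPMF PY) (n : ℕ) : ∑ b', ⌊PY b' * n⌋₊ ≤ n := by
  have := sum_floor_le univ PY hPY.1 n
  rw [hPY.2, one_mul] at this
  exact_mod_cast this

lemma NY_sum (PY : A → ℝ) (hPY : IsPMF PY) (b0 : A) (n : ℕ) : ∑ b, NY PY b0 n b = n := by
  have := NY_le PY hPY n
  simp only [NY, Finset.sum_add_distrib, Finset.sum_ite_eq', Finset.mem_univ, if_true]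
  omega

lemma JQ_le (Q : A × A → ℝ) (hQ : IsPMF Q) (b0 : A) (n : ℕ) (b : A) :
    ∑ a' ∈ univ.erase b, ⌊Q (a', b) * n⌋₊ ≤ NY (margY Q) b0 n b := by
  have h1 : ∑ a' ∈ univ.erase b, ⌊Q (a', b) * n⌋₊ ≤ ⌊margY Q b * n⌋₊ := by
    refine Nat.le_floor ?_
    push_cast
    refine (sum_floor_le (univ.erase b) (fun a' => Q (a', b)) (fun _ => hQ.1 _) n).trans ?_
    refine mul_le_mul_of_nonneg_right ?_ (by positivity)
    exact Finset.sum_le_sum_of_subset_of_nonneg (Finset.erase_subset _ _) fun _ _ _ => hQ.1 _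
  unfold NY
  omega

lemma JQ_sum (Q : A × A → ℝ) (hQ : IsPMF Q) (b0 : A) (n : ℕ) (b : A) :
    ∑ a, JQ Q (margY Q) b0 n (a, b) = NY (margY Q) b0 n b := by
  rw [← Finset.add_sum_erase univ _ (Finset.mem_univ b)]
  have h : ∑ a ∈ univ.erase b, JQ Q (margY Q) b0 n (a, b)
      = ∑ a' ∈ univ.erase b, ⌊Q (a', b) * n⌋₊ := by
    refine Finset.sum_congr rfl fun a ha => ?_
    have : a ≠ b := (Finset.mem_erase.1 ha).1
    simp [JQ, this]
  rw [h]
  have := JQ_le Q hQ b0 n b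
  simp only [JQ, if_true]
  omega

lemma approx_x (d : A → A → ℝ) (hd : ∀ a b, 0 ≤ d a b) (hdrefl : ∀ a, d a a = 0)
    (Δ : ℝ) (Q : A × A → ℝ) (hQ : IsPMF Q) (hE : expDist d Q ≤ Δ) (b0 : A) (n : ℕ) (hn : 0 < n)
    (y : Fin n → A) (hy : ∀ b, (univ.filter fun i => y i = b).card = NY (margY Q) b0 n b) :
    ∃ x : Fin n → A, dSeq d x y ≤ n * Δ ∧
      empP x = fun a => ∑ b, (JQ Q (margY Q) b0 n (a, b) : ℝ) / n := by
  obtain ⟨x, hx⟩ := exists_x y (JQ Q (margY Q) b0 n) (fun b => by rw [JQ_sum Q hQ, hy])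
  have hn' : (0 : ℝ) < n := by exact_mod_cast hn
  refine ⟨x, ?_, ?_⟩
  · rw [expDist_emp]
    refine mul_le_mul_of_nonneg_left (le_trans ?_ hE) hn'.le
    unfold expDist
    refine Finset.sum_le_sum fun q _ => ?_
    by_cases h : q.1 = q.2
    · rw [h, hdrefl]; simp
    · refine mul_le_mul_of_nonneg_right ?_ (hd _ _)
      unfold empP
      rw [hx q, div_le_iff₀ hn']
      simp only [JQ, h, if_false]
      exact Nat.floor_le (mul_nonneg (hQ.1 _) hn'.le)
  · rw [← margX_emp x y]
    funext a
    unfold margX empP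
    simp only [hx]

lemma tendsto_floor (q : ℝ) (hq : 0 ≤ q) :
    Tendsto (fun n : ℕ => (⌊q * n⌋₊ : ℝ) / n) atTop (nhds q) :=
  (tendsto_nat_floor_mul_div_atTop hq).comp tendsto_natCast_atTop_atTop

lemma tendsto_NY (PY : A → ℝ) (hPY : IsPMF PY) (b0 b : A) :
    Tendsto (fun n : ℕ => (NY PY b0 n b : ℝ) / n) atTop (nhds (PY b)) := by
  have h1 := tendsto_floor (PY b) (hPY.1 b)
  have h2 : Tendsto (fun n : ℕ => (1 : ℝ) - ∑ b', (⌊PY b' * n⌋₊ : ℝ) / n) atTop (nhds 0) := by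
    have := tendsto_const_nhds (x := (1 : ℝ)).sub
      (tendsto_finsetSum univ fun b' _ => tendsto_floor (PY b') (hPY.1 b'))
    rw [hPY.2] at this
    simpa using this
  have h3 : Tendsto (fun n : ℕ => (⌊PY b * n⌋₊ : ℝ) / n +
      if b = b0 then (1 : ℝ) - ∑ b', (⌊PY b' * n⌋₊ : ℝ) / n else 0) atTop (nhds (PY b)) := by
    split_ifs
    · simpa using h1.add h2
    · simpa using h1
  refine h3.congr' ?_
  filter_upwards [eventually_gt_atTop 0] with n hn
  have hn' : (n : ℝ) ≠ 0 := by positivity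
  unfold NY
  push_cast
  rw [Nat.cast_sub (NY_le PY hPY n), add_div]
  congr 1
  split_ifs
  · rw [← Finset.sum_div, sub_div, div_self hn']; push_cast; rfl
  · simp

lemma margY_pmf (Q : A × A → ℝ) (hQ : IsPMF Q) : IsPMF (margY Q) := by
  refine ⟨fun a => Finset.sum_nonneg fun b _ => hQ.1 _, ?_⟩
  rw [← hQ.2, Fintype.sum_prod_type_right]
  rfl

lemma tendsto_JQ (Q : A × A → ℝ) (hQ : IsPMF Q) (b0 : A) (q : A × A) :
    Tendsto (fun n : ℕ => (JQ Q (margY Q) b0 n q : ℝ) / n) atTop (nhds (Q q)) := by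
  obtain ⟨a, b⟩ := q
  by_cases h : a = b
  · subst h
    have h1 := (tendsto_NY (margY Q) (margY_pmf Q hQ) b0 a).sub
      (tendsto_finsetSum (univ.erase a) fun a' _ => tendsto_floor (Q (a', a)) (hQ.1 _))
    have h2 : margY Q a - ∑ a' ∈ univ.erase a, Q (a', a) = Q (a, a) := by
      unfold margY
      rw [← Finset.add_sum_erase univ _ (Finset.mem_univ a)]
      ring
    rw [h2] at h1
    refine h1.congr fun n => ?_
    simp only [JQ, if_true]
    rw [Nat.cast_sub (JQ_le Q hQ b0 n a), sub_div]
    push_cast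
    rw [Finset.sum_div]
  · simp only [JQ, h, if_false]
    exact tendsto_floor _ (hQ.1 _)

lemma tendsto_kl (f : ℕ → A → ℝ) (q P : A → ℝ) (hf : ∀ n a, 0 ≤ f n a) (hq : ∀ a, 0 ≤ q a)
    (hP : ∀ a, 0 < P a) (h : ∀ a, Tendsto (fun n => f n a) atTop (nhds (q a))) :
    Tendsto (fun n => klDiv (f n) P) atTop (nhds (klDiv q P)) := by
  have key : ∀ Q : A → ℝ, (∀ a, 0 ≤ Q a) →
      klDiv Q P = ∑ a, (Q a * Real.log (Q a) - Q a * Real.log (P a)) := by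
    intro Q hQ
    rw [klDiv_eq Q P hQ]
    refine Finset.sum_congr rfl fun a _ => ?_
    by_cases h0 : Q a = 0
    · simp [h0]
    · rw [Real.log_div h0 (hP a).ne']; ring
  rw [key q hq]
  simp only [key _ (hf _)]
  refine tendsto_finsetSum _ fun a _ => ?_
  exact ((Real.continuous_mul_log.tendsto (q a)).comp (h a)).sub ((h a).mul_const _)

lemma tendsto_kl_JQ (Q : A × A → ℝ) (hQ : IsPMF Q) (b0 : A) (P : A → ℝ) (hP : ∀ a, 0 < P a) :
    Tendsto (fun n : ℕ => klDiv (fun a => ∑ b, (JQ Q (margY Q) b0 n (a, b) : ℝ) / n) P)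
      atTop (nhds (klDiv (margX Q) P)) := by
  refine tendsto_kl _ _ P (fun n a => by positivity) (marg_pmf Q hQ).1 hP fun a => ?_
  exact tendsto_finsetSum _ fun b _ => tendsto_JQ Q hQ b0 (a, b)

lemma tendsto_log_poly (C : ℝ) (hC : 0 < C) (K : ℕ) :
    Tendsto (fun n : ℕ => Real.log (C * ((n : ℝ) + 1) ^ K) / n) atTop (nhds 0) := by
  have h1 : Tendsto (fun n : ℕ => Real.log C / n) atTop (nhds 0) :=
    tendsto_const_div_atTop_nhds_zero_nat _
  have h2 : Tendsto (fun n : ℕ => Real.log ((n : ℝ) + 1) / n) atTop (nhds 0) := by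
    have h3 : Tendsto (fun n : ℕ => Real.log ((n : ℝ) + 1) / ((n : ℝ) + 1)) atTop (nhds 0) := by
      have := (Real.isLittleO_log_id_atTop.tendsto_div_nhds_zero).comp
        (tendsto_atTop_add_const_right atTop (1 : ℝ) (tendsto_natCast_atTop_atTop (R := ℝ)))
      exact this
    have h4 : Tendsto (fun n : ℕ => 1 + 1 / (n : ℝ)) atTop (nhds (1 + 0)) :=
      tendsto_const_nhds.add tendsto_one_div_atTop_nhds_zero_nat
    have h5 := h3.mul h4
    rw [zero_mul] at h5
    refine h5.congr' ?_
    filter_upwards [eventually_gt_atTop 0] with n hn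
    have hn' : (n : ℝ) ≠ 0 := by positivity
    have hn2 : (n : ℝ) + 1 ≠ 0 := by positivity
    field_simp
  have h6 := h1.add (h2.const_mul (K : ℝ))
  simp only [mul_zero, add_zero] at h6
  refine h6.congr fun n => ?_
  have hn2 : (n : ℝ) + 1 ≠ 0 := by positivity
  rw [Real.log_mul hC.ne' (by positivity), Real.log_pow, add_div, mul_div_assoc]

end Helpers

/-- Theorem 7: exponent of the equilibrium Bayes payoff. -/
theorem bayes_payoff_exponent
    {A : Type} [Fintype A] [DecidableEq A] [Nonempty A]
    (d : A → A → ℝ) (hd : ∀ a b, 0 ≤ d a b) (hdrefl : ∀ a, d a a = 0)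
    (P0 P1 : A → ℝ) (hP0 : IsPMF P0) (hP1 : IsPMF P1)
    (hP0pos : ∀ a, 0 < P0 a) (hP1pos : ∀ a, 0 < P1 a)
    (Δ0 Δ1 a : ℝ) (hΔ0 : 0 ≤ Δ0) (hΔ1 : 0 ≤ Δ1) (ha : 0 ≤ a) :
    (∀ n : ℕ, 0 < bayesPayoff d Δ0 Δ1 a P0 P1 n) ∧
    Tendsto
      (fun n : ℕ => -(1 / (n : ℝ)) * Real.log (bayesPayoff d Δ0 Δ1 a P0 P1 n))
      atTop
      (nhds (sInf {v | ∃ PY : A → ℝ, IsPMF PY ∧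
        v = max (Dtilde d Δ1 PY P1) (Dtilde d Δ0 PY P0 - a)})) := by
  refine ⟨fun n => bayes_pos d hdrefl P0 P1 hP0pos hP1pos Δ0 Δ1 a hΔ0 hΔ1 n, ?_⟩
  have hpos := fun n => bayes_pos d hdrefl P0 P1 hP0pos hP1pos Δ0 Δ1 a hΔ0 hΔ1 n
  set S := {v | ∃ PY : A → ℝ, IsPMF PY ∧
        v = max (Dtilde d Δ1 PY P1) (Dtilde d Δ0 PY P0 - a)} with hS
  have hbdd : BddBelow S := by
    refine ⟨0, ?_⟩
    rintro v ⟨PY, _, rfl⟩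
    exact le_max_of_le_left (Dtilde_nonneg d Δ1 PY P1 hP1 hP1pos)
  have hne : S.Nonempty := ⟨_, P0, hP0, rfl⟩
  have hV : ∀ PY : A → ℝ, IsPMF PY →
      sInf S ≤ max (Dtilde d Δ1 PY P1) (Dtilde d Δ0 PY P0 - a) := fun PY h =>
    csInf_le hbdd ⟨PY, h, rfl⟩
  obtain ⟨b0⟩ := ‹Nonempty A›
  set V := sInf S with hVdef
  rw [Metric.tendsto_nhds]
  intro ε hε
  -- upper deviation data
  obtain ⟨v, ⟨PY, hPY, rfl⟩, hv⟩ := exists_lt_of_csInf_lt hne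
    (show sInf S < V + ε / 2 by rw [← hVdef]; linarith)
  have hv1 := (le_max_left _ _).trans_lt hv
  have hv0 := (le_max_right _ _).trans_lt hv
  obtain ⟨_, ⟨Q1, hQ1, hm1, he1, rfl⟩, hk1⟩ := exists_lt_of_csInf_lt
    (Dtilde_nonempty d hdrefl Δ1 hΔ1 PY P1 hPY) hv1
  obtain ⟨_, ⟨Q0, hQ0, hm0, he0, rfl⟩, hk0⟩ := exists_lt_of_csInf_lt
    (Dtilde_nonempty d hdrefl Δ0 hΔ0 PY P0 hPY)
    (show sInf _ < V + ε / 2 + a from by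
      have : Dtilde d Δ0 PY P0 < V + ε / 2 + a := by linarith
      exact this)
  have t1 := (tendsto_kl_JQ Q1 hQ1 b0 P1 hP1pos).eventually_lt_const hk1
  have t0 := (tendsto_kl_JQ Q0 hQ0 b0 P0 hP0pos).eventually_lt_const hk0
  have r1 := (tendsto_log_poly 2 (by norm_num) (Fintype.card A)).eventually_lt_const hε
  have r2 := (tendsto_log_poly (Real.exp 1 ^ Fintype.card A) (by positivity)
    (Fintype.card A * Fintype.card A + Fintype.card A)).eventually_lt_const (half_pos hε)
  filter_upwards [t1, t0, r1, r2, eventually_gt_atTop 0] with n t1 t0 r1 r2 hn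
  have hn' : (0 : ℝ) < n := by exact_mod_cast hn
  have hu := hpos n
  have hup := bayes_upper d hdrefl P0 P1 hP0 hP1 hP0pos hP1pos Δ0 Δ1 a hΔ0 hΔ1 n hn V hV
  have hlow : Real.exp (-(n * (V + ε / 2))) ≤
      ((n : ℝ) + 1) ^ (Fintype.card A * Fintype.card A) *
      (Real.exp 1 * (n + 1)) ^ Fintype.card A * bayesPayoff d Δ0 Δ1 a P0 P1 n := by
    obtain ⟨y, hy⟩ := exists_fun (n := n) (NY PY b0 n) (NY_sum PY hPY b0 n)
    obtain ⟨x1, hx1, hx1'⟩ := approx_x d hd hdrefl Δ1 Q1 hQ1 he1 b0 n hn y (by rw [hm1]; exact hy)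
    obtain ⟨x0, hx0, hx0'⟩ := approx_x d hd hdrefl Δ0 Q0 hQ0 he0 b0 n hn y (by rw [hm0]; exact hy)
    refine bayes_lower d P0 P1 hP0pos hP1pos Δ0 Δ1 a n hn _ x0 x1 y hx0 hx1 ?_ ?_
    · rw [hx0']; linarith
    · rw [hx1']; linarith
  have l1 := Real.log_le_log hu hup
  rw [Real.log_mul (by positivity) (by positivity), Real.log_exp] at l1
  have l2 := Real.log_le_log (Real.exp_pos _) hlow
  rw [Real.log_mul (by positivity) hu.ne', Real.log_exp] at l2
  have hR : ((n : ℝ) + 1) ^ (Fintype.card A * Fintype.card A) *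
      (Real.exp 1 * (n + 1)) ^ Fintype.card A = Real.exp 1 ^ Fintype.card A *
      ((n : ℝ) + 1) ^ (Fintype.card A * Fintype.card A + Fintype.card A) := by
    rw [mul_pow, pow_add]; ring
  rw [hR] at l2
  rw [div_lt_iff₀ hn'] at r1 r2
  rw [Real.dist_eq, abs_lt]
  set L := Real.log (bayesPayoff d Δ0 Δ1 a P0 P1 n)
  have hLe : -(1 / (n : ℝ)) * L = (-L) / n := by ring
  rw [hLe]
  constructor
  · have : V - ε < (-L) / n := by rw [lt_div_iff₀ hn']; nlinarith
    linarith
  · have : (-L) / n < V + ε := by rw [div_lt_iff₀ hn']; nlinarith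
    linarith
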